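/- arXiv:2205.00450 — 2 statements merged into one kernel-verified Lean document; each statement's English description precedes it below -/
import Mathlib

section
/- The constrained random arrival rule does not satisfy population monotonicity: there exist a multi-issue bankruptcy problem with crossed claims (I, N, E, c, α) and claimants j, k ∈ N with k ≠ j such that CRA_k(I, N∖{j}, E^{-j}, c_{-j}, α) > CRA_k(I, N, E, c, α), where E^{-j} is obtained from E by setting e_i^{-j} = e_i − c_j for i ∈ α(j) and e_i^{-j} = e_i otherwise, and c_{-j} is c with the j-th coordinate deleted. -/
open Finset

/-- The constrained sequential priority allocation `CSP^σ` of a multi-issue bankruptcy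
problem with crossed claims, defined recursively in increasing `σ`-order:
`CSP^σ_j = min (c j) (max 0 (min_{i ∈ α j} (e i - ∑_{k : i ∈ α k, σ k < σ j} CSP^σ_k)))`.
The minimum over the (nonempty) finite set `α j` is expressed via `sInf`. -/
noncomputable def CSP {I N : Type*} [Fintype I] [Fintype N] [DecidableEq I] [DecidableEq N]
    (e : I → ℝ) (c : N → ℝ) (α : N → Finset I) (σ : N → ℕ) (j : N) : ℝ :=
  min (c j)
    (max 0 (sInf (↑((α j).image fun i =>
      e i - ∑ k ∈ (Finset.univ.filter fun k => i ∈ α k ∧ σ k < σ j).attach,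
        CSP e c α σ k.1) : Set ℝ)))
termination_by σ j
decreasing_by
  have hk := k.2
  simp only [Finset.mem_filter, Finset.mem_univ, true_and] at hk
  exact hk.2

/-- `(I, N, E, c, α)` is a multi-issue bankruptcy problem with crossed claims. -/
def IsMBC {I N : Type*} [Fintype I] [Fintype N] [DecidableEq I] [DecidableEq N]
    (e : I → ℝ) (c : N → ℝ) (α : N → Finset I) : Prop :=
  Nonempty I ∧ Nonempty N ∧ (∀ i, 0 ≤ e i) ∧ (∀ j, 0 ≤ c j) ∧ (∀ j, (α j).Nonempty) ∧
    ∀ i, e i < ∑ j ∈ Finset.univ.filter (fun j => i ∈ α j), c j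

/-- `x` is a feasible allocation of the problem `(I, N, E, c, α)`. -/
def Feasible {I N : Type*} [Fintype I] [Fintype N] [DecidableEq I] [DecidableEq N]
    (e : I → ℝ) (c : N → ℝ) (α : N → Finset I) (x : N → ℝ) : Prop :=
  (∀ j, 0 ≤ x j) ∧ (∀ j, x j ≤ c j) ∧
    ∀ i, ∑ j ∈ Finset.univ.filter (fun j => i ∈ α j), x j ≤ e i

/-- `x` is Pareto efficient: no feasible allocation weakly dominates it with a strict gain. -/
def ParetoEff {I N : Type*} [Fintype I] [Fintype N] [DecidableEq I] [DecidableEq N]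
    (e : I → ℝ) (c : N → ℝ) (α : N → Finset I) (x : N → ℝ) : Prop :=
  ¬ ∃ a : N → ℝ, Feasible e c α a ∧ (∀ j, x j ≤ a j) ∧ ∃ j, x j < a j

/-- The constrained random arrival rule: the average over all `|N|!` orders
(bijections `N ≃ Fin |N|`) of the constrained sequential priority allocations. -/
noncomputable def CRA {I N : Type*} [Fintype I] [Fintype N] [DecidableEq I] [DecidableEq N]
    (e : I → ℝ) (c : N → ℝ) (α : N → Finset I) (j : N) : ℝ :=
  (∑ σ : N ≃ Fin (Fintype.card N), CSP e c α (fun k => (σ k : ℕ)) j) /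
    (Nat.factorial (Fintype.card N) : ℝ)


theorem CSP_nonneg_aux {I N : Type*} [Fintype I] [Fintype N] [DecidableEq I] [DecidableEq N]
    (e : I → ℝ) (c : N → ℝ) (α : N → Finset I) (σ : N → ℕ) (j : N) (hc : 0 ≤ c j) :
    0 ≤ CSP e c α σ j := by
  rw [CSP]; exact le_min hc (le_max_left _ _)

theorem CSP_le_aux {I N : Type*} [Fintype I] [Fintype N] [DecidableEq I] [DecidableEq N]
    (e : I → ℝ) (c : N → ℝ) (α : N → Finset I) (σ : N → ℕ) (j : N) :
    CSP e c α σ j ≤ c j := by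
  rw [CSP]; exact min_le_left _ _

/-- A claimant of an exhausted issue gets nothing. -/
theorem CSP_eq_zero_aux {I N : Type*} [Fintype I] [Fintype N] [DecidableEq I] [DecidableEq N]
    (e : I → ℝ) (c : N → ℝ) (α : N → Finset I) (σ : N → ℕ) (j : N) (hc : ∀ k, 0 ≤ c k)
    (i : I) (hi : i ∈ α j) (he : e i ≤ 0) :
    CSP e c α σ j = 0 := by
  apply le_antisymm _ (CSP_nonneg_aux _ _ _ _ _ (hc j))
  rw [CSP]
  refine (min_le_right _ _).trans (max_le le_rfl ?_)
  refine (csInf_le (Finset.bddBelow _)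
    (Finset.mem_coe.2 (Finset.mem_image_of_mem _ hi))).trans ?_
  have := Finset.sum_nonneg (s := (Finset.univ.filter fun k => i ∈ α k ∧ σ k < σ j).attach)
    (f := fun k => CSP e c α σ k.1) (fun k _ => CSP_nonneg_aux e c α σ k.1 (hc _))
  linarith

/-- The allocation of a claimant who claims from a single issue. -/
theorem CSP_single_aux {I N : Type*} [Fintype I] [Fintype N] [DecidableEq I] [DecidableEq N]
    (e : I → ℝ) (c : N → ℝ) (α : N → Finset I) (σ : N → ℕ) (j : N)
    (i : I) (hi : α j = {i}) :
    CSP e c α σ j = min (c j) (max 0 (e i -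
      ∑ k ∈ Finset.univ.filter (fun k => i ∈ α k ∧ σ k < σ j), CSP e c α σ k)) := by
  rw [CSP, hi, Finset.image_singleton, Finset.coe_singleton, csInf_singleton,
    Finset.sum_attach _ (fun k => CSP e c α σ k)]

/-- The first claimant in the order, in case all her issues hold at least her claim,
gets her whole claim. -/
theorem CSP_first_aux {I N : Type*} [Fintype I] [Fintype N] [DecidableEq I] [DecidableEq N]
    (e : I → ℝ) (c : N → ℝ) (α : N → Finset I) (σ : N → ℕ) (j : N)
    (hα : (α j).Nonempty) (hσ : σ j = 0) (h : ∀ i ∈ α j, c j ≤ e i) :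
    CSP e c α σ j = c j := by
  rw [CSP]
  refine min_eq_left (le_max_of_le_right (le_csInf ?_ ?_))
  · exact_mod_cast hα.image _
  · intro b hb
    obtain ⟨i, hi, rfl⟩ := Finset.mem_image.1 (Finset.mem_coe.1 hb)
    rw [Finset.sum_attach _ (fun k => CSP e c α σ k)]
    simpa [hσ] using h i hi

theorem CRA_not_populationMonotone :
    ∃ (nI nN : ℕ) (e : Fin nI → ℝ) (c : Fin nN → ℝ) (α : Fin nN → Finset (Fin nI)),
      IsMBC e c α ∧
      ∃ (j k : Fin nN) (hkj : k ≠ j),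
        CRA e c α k <
          CRA (fun i => if i ∈ α j then e i - c j else e i)
            (fun x : {x : Fin nN // x ≠ j} => c x.1)
            (fun x : {x : Fin nN // x ≠ j} => α x.1)
            ⟨k, hkj⟩ := by
  refine ⟨2, 3, fun _ => 1, fun _ => 1, ![{0}, {0, 1}, {1}], ?_, 0, 2, by decide, ?_⟩
  · refine ⟨inferInstance, inferInstance, by simp, by simp, ?_, ?_⟩
    · intro j; fin_cases j <;> simp
    · intro i
      have h : ∀ i : Fin 2, 1 < (Finset.univ.filter
        (fun j : Fin 3 => i ∈ (![{0}, {0, 1}, {1}] : Fin 3 → Finset (Fin 2)) j)).card := by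
        decide
      simp only [Finset.sum_const, nsmul_eq_mul, mul_one]
      exact_mod_cast h i
  · set α : Fin 3 → Finset (Fin 2) := ![{0}, {0, 1}, {1}] with hα
    -- in the original problem claimant `2` gets less than `1`
    have h1 : CRA (fun _ => (1 : ℝ)) (fun _ => (1 : ℝ)) α 2 < 1 := by
      rw [CRA, div_lt_one (by positivity)]
      have hs : ∑ σ : Fin 3 ≃ Fin (Fintype.card (Fin 3)), (1 : ℝ)
          = (Nat.factorial (Fintype.card (Fin 3)) : ℝ) := by
        rw [Finset.sum_const, Finset.card_univ, Fintype.card_equiv (Fintype.equivFin _)]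
        simp
      rw [← hs]
      refine Finset.sum_lt_sum (fun σ _ => CSP_le_aux _ _ _ _ _)
        ⟨(Equiv.swap (0 : Fin 3) 1 : Fin 3 ≃ Fin 3), Finset.mem_univ _, ?_⟩
      rw [CSP_single_aux _ _ _ _ _ 1 (by simp [hα])]
      refine min_lt_of_right_lt (max_lt one_pos ?_)
      have hm := CSP_first_aux (fun _ => (1 : ℝ)) (fun _ => (1 : ℝ)) α
        (fun k => ((Equiv.swap (0 : Fin 3) 1 k : Fin 3) : ℕ)) 1 (by simp [hα]) (by simp) (by simp)
      have hle := Finset.single_le_sum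
        (s := Finset.univ.filter (fun k => (1 : Fin 2) ∈ α k ∧
          ((Equiv.swap (0 : Fin 3) 1 k : Fin 3) : ℕ) < ((Equiv.swap (0 : Fin 3) 1 2 : Fin 3) : ℕ)))
        (f := fun k => CSP (fun _ => (1 : ℝ)) (fun _ => (1 : ℝ)) α
          (fun k => ((Equiv.swap (0 : Fin 3) 1 k : Fin 3) : ℕ)) k)
        (fun k _ => CSP_nonneg_aux _ _ _ _ _ zero_le_one)
        (a := 1) (by rw [Finset.mem_filter, hα]; decide)
      simp only [hm] at hle
      have : ∀ x : ℝ, 1 ≤ x → 1 - x < 1 := fun x hx => by linarith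
      exact this _ hle
    -- in the reduced problem she gets `1`
    refine h1.trans_le (le_of_eq ?_)
    rw [CRA, eq_comm, div_eq_one_iff_eq (by positivity)]
    have hs : ∑ σ : {x : Fin 3 // x ≠ 0} ≃ Fin (Fintype.card {x : Fin 3 // x ≠ 0}), (1 : ℝ)
          = (Nat.factorial (Fintype.card {x : Fin 3 // x ≠ 0}) : ℝ) := by
      rw [Finset.sum_const, Finset.card_univ, Fintype.card_equiv (Fintype.equivFin _)]
      simp
    rw [← hs]
    refine Finset.sum_congr rfl (fun σ _ => ?_)
    rw [CSP_single_aux _ _ _ _ _ 1 (by simp [hα]), Finset.sum_eq_zero]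
    · simp [hα]
    · rintro ⟨k, hk⟩ hmem
      rw [Finset.mem_filter] at hmem
      fin_cases k
      · exact absurd rfl hk
      · exact CSP_eq_zero_aux _ _ _ _ _ (fun _ => zero_le_one) 0 (by simp [hα]) (by simp [hα])
      · exact absurd hmem.2.2 (lt_irrefl _)
end

section
/- The constrained random arrival rule does not satisfy balanced impact: there exist a multi-issue bankruptcy problem with crossed claims (I, N, E, c, α) and claimants j, k ∈ N such that CRA_j(I,N,E,c,α) − CRA_j(I, N∖{k}, E^{-k}, c_{-k}, α) ≠ CRA_k(I,N,E,c,α) − CRA_k(I, N∖{j}, E^{-j}, c_{-j}, α), where for h ∈ {j,k}, E^{-h} is obtained from E by setting e_i^{-h} = e_i − c_h for i ∈ α(h) and e_i^{-h} = e_i otherwise, and c_{-h} is c with the h-th coordinate deleted. -/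
open Finset

theorem CSP_eq {I N : Type*} [Fintype I] [Fintype N] [DecidableEq I] [DecidableEq N]
    (e : I → ℝ) (c : N → ℝ) (α : N → Finset I) (σ : N → ℕ) (j : N) :
    CSP e c α σ j = min (c j) (max 0 (sInf (↑((α j).image fun i =>
      e i - ∑ k ∈ Finset.univ.filter (fun k => i ∈ α k ∧ σ k < σ j),
        CSP e c α σ k) : Set ℝ))) := by
  rw [CSP]
  have h : ∀ i, ∑ k ∈ (Finset.univ.filter fun k => i ∈ α k ∧ σ k < σ j).attach,
      CSP e c α σ k.1 = ∑ k ∈ Finset.univ.filter (fun k => i ∈ α k ∧ σ k < σ j),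
        CSP e c α σ k := fun i => Finset.sum_attach _ (fun k => CSP e c α σ k)
  simp only [h]

theorem CSP_nonneg {I N : Type*} [Fintype I] [Fintype N] [DecidableEq I] [DecidableEq N]
    (e : I → ℝ) (c : N → ℝ) (α : N → Finset I) (σ : N → ℕ) (j : N) (hc : ∀ j, 0 ≤ c j) :
    0 ≤ CSP e c α σ j := by
  rw [CSP_eq]
  exact le_min (hc j) (le_max_left _ _)

/-- A claimant gets nothing if one of her issues is exhausted. -/
theorem CSP_zero {I N : Type*} [Fintype I] [Fintype N] [DecidableEq I] [DecidableEq N]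
    (e : I → ℝ) (c : N → ℝ) (α : N → Finset I) (σ : N → ℕ) (j : N) (hc : ∀ j, 0 ≤ c j)
    (i : I) (hi : i ∈ α j) (he : e i ≤ 0) : CSP e c α σ j = 0 := by
  apply le_antisymm _ (CSP_nonneg e c α σ j hc)
  rw [CSP_eq]
  refine (min_le_right _ _).trans (max_le le_rfl ?_)
  refine (csInf_le (Finset.bddBelow _)
    (Finset.mem_coe.2 (Finset.mem_image_of_mem _ hi))).trans ?_
  have := Finset.sum_nonneg (s := Finset.univ.filter (fun k => i ∈ α k ∧ σ k < σ j))
    (f := fun k => CSP e c α σ k) (fun k _ => CSP_nonneg e c α σ k hc)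
  linarith

theorem CRA_zero {I N : Type*} [Fintype I] [Fintype N] [DecidableEq I] [DecidableEq N]
    (e : I → ℝ) (c : N → ℝ) (α : N → Finset I) (j : N) (hc : ∀ j, 0 ≤ c j)
    (i : I) (hi : i ∈ α j) (he : e i ≤ 0) : CRA e c α j = 0 := by
  unfold CRA
  simp [CSP_zero e c α _ j hc i hi he]

/-- Claimant 0 claims from issue 0, claimant 1 from both, claimant 2 from issue 1. -/
def exα : Fin 3 → Finset (Fin 2) := ![{0}, {0, 1}, {1}]

theorem exα0 : exα 0 = {0} := rfl
theorem exα1 : exα 1 = {0, 1} := rfl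
theorem exα2 : exα 2 = {1} := rfl

theorem ex0 (σ : Fin 3 → ℕ) : CSP (fun _ => 1) (fun _ => 1) exα σ 0 =
    min 1 (max 0 (1 - if σ 1 < σ 0 then CSP (fun _ => 1) (fun _ => 1) exα σ 1 else 0)) := by
  rw [CSP_eq]
  simp [exα0, exα1, exα2, Finset.sum_filter, Fin.sum_univ_three]

theorem ex2 (σ : Fin 3 → ℕ) : CSP (fun _ => 1) (fun _ => 1) exα σ 2 =
    min 1 (max 0 (1 - if σ 1 < σ 2 then CSP (fun _ => 1) (fun _ => 1) exα σ 1 else 0)) := by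
  rw [CSP_eq]
  simp [exα0, exα1, exα2, Finset.sum_filter, Fin.sum_univ_three]

theorem ex1 (σ : Fin 3 → ℕ) : CSP (fun _ => 1) (fun _ => 1) exα σ 1 =
    min 1 (max 0 (min
      (1 - if σ 0 < σ 1 then CSP (fun _ => 1) (fun _ => 1) exα σ 0 else 0)
      (1 - if σ 2 < σ 1 then CSP (fun _ => 1) (fun _ => 1) exα σ 2 else 0))) := by
  rw [CSP_eq]
  simp [exα0, exα1, exα2, Finset.sum_filter, Fin.sum_univ_three]

theorem ex1' (σ : Fin 3 → ℕ) (hσ : Function.Injective σ) :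
    CSP (fun _ => 1) (fun _ => 1) exα σ 1 = if σ 1 < σ 0 ∧ σ 1 < σ 2 then 1 else 0 := by
  have h01 : σ 0 ≠ σ 1 := fun h => absurd (hσ h) (by decide)
  have h21 : σ 2 ≠ σ 1 := fun h => absurd (hσ h) (by decide)
  have n0 := CSP_nonneg (fun _ => 1) (fun _ => 1) exα σ 0 (fun _ => zero_le_one)
  have n2 := CSP_nonneg (fun _ => 1) (fun _ => 1) exα σ 2 (fun _ => zero_le_one)
  have e0 := ex0 σ
  have e1 := ex1 σ
  have e2 := ex2 σ
  rcases lt_or_gt_of_ne h01 with h | h <;> rcases lt_or_gt_of_ne h21 with h' | h' <;>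
    simp [h, h', h.not_gt, h'.not_gt] at e0 e1 e2 ⊢ <;> simp [e0, e1, e2]

theorem ex0' (σ : Fin 3 → ℕ) (hσ : Function.Injective σ) :
    CSP (fun _ => 1) (fun _ => 1) exα σ 0 = if σ 1 < σ 0 ∧ σ 1 < σ 2 then 0 else 1 := by
  rw [ex0, ex1' σ hσ]
  by_cases h : σ 1 < σ 0 <;> by_cases h' : σ 1 < σ 2 <;> simp [h, h']

/-- the constrained random arrival rule does not satisfy balanced impact:
there are an MBC problem and claimants `j, k` such that the impact of `k`'s departure
(with her full claim) on `j` differs from the impact of `j`'s departure on `k`. -/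
theorem CRA_not_balancedImpact :
    ∃ (nI nN : ℕ) (e : Fin nI → ℝ) (c : Fin nN → ℝ) (α : Fin nN → Finset (Fin nI)),
      IsMBC e c α ∧
      ∃ (j k : Fin nN) (hjk : j ≠ k),
        CRA e c α j -
          CRA (fun i => if i ∈ α k then e i - c k else e i)
            (fun x : {x : Fin nN // x ≠ k} => c x.1)
            (fun x : {x : Fin nN // x ≠ k} => α x.1)
            ⟨j, hjk⟩
        ≠ CRA e c α k -
          CRA (fun i => if i ∈ α j then e i - c j else e i)
            (fun x : {x : Fin nN // x ≠ j} => c x.1)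
            (fun x : {x : Fin nN // x ≠ j} => α x.1)
            ⟨k, hjk.symm⟩ := by
  have hc : ∀ N : Type, ∀ j : N, (0 : ℝ) ≤ (fun _ => 1 : N → ℝ) j := fun _ _ => zero_le_one
  refine ⟨2, 3, fun _ => 1, fun _ => 1, exα, ⟨⟨0⟩, ⟨0⟩, fun _ => zero_le_one, hc _, ?_, ?_⟩,
    0, 1, by decide, ?_⟩
  · decide
  · intro i
    fin_cases i <;> simp <;> decide
  rw [CRA_zero (fun i => if i ∈ exα 1 then (1 : ℝ) - 1 else 1) _ _ _ (fun _ => zero_le_one) 0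
      (by simp [exα0]) (by simp [exα1]),
    CRA_zero (fun i => if i ∈ exα 0 then (1 : ℝ) - 1 else 1) _ _ _ (fun _ => zero_le_one) 0
      (by simp [exα1]) (by simp [exα0])]
  have inj : ∀ σ : Fin 3 ≃ Fin (Fintype.card (Fin 3)),
      Function.Injective (fun k => (σ k : ℕ)) :=
    fun σ => Fin.val_injective.comp σ.injective
  unfold CRA
  simp only [fun σ => ex0' _ (inj σ), fun σ => ex1' _ (inj σ)]
  have k1 : (Finset.univ.filter (fun σ : Fin 3 ≃ Fin (Fintype.card (Fin 3)) =>
      (σ 1 : ℕ) < σ 0 ∧ (σ 1 : ℕ) < σ 2)).card = 2 := by decide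
  have k2 : (Finset.univ.filter (fun σ : Fin 3 ≃ Fin (Fintype.card (Fin 3)) =>
      ¬ ((σ 1 : ℕ) < σ 0 ∧ (σ 1 : ℕ) < σ 2))).card = 4 := by decide
  rw [Finset.sum_ite, Finset.sum_ite]
  simp only [Finset.sum_const, k1, k2, Fintype.card_fin]
  norm_num [Nat.factorial]
end
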